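/- Let n, a, b be nonnegative integers with n ≥ 2. Then the Hirzebruch–Jung continued fraction of the sequence consisting of a copies of 2, followed by n, followed by b copies of 2 satisfies [[(2)^a, n, (2)^b]] = ( ((a+1)n − (2a+1))·b + (a+1)n − a ) / ( (an − (2a−1))·b + an − (a−1) ). -/

import Mathlib

/-- The Hirzebruch–Jung continued fraction `[[a₁, …, aₙ]]`, defined recursively by
`[[aₙ]] = aₙ` and `[[a₁, …, aₙ]] = a₁ - 1/[[a₂, …, aₙ]]`. The value on the empty
list is junk. -/
noncomputable def hj : List ℝ → ℝ
  | [] => 0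
  | [a] => a
  | a :: b :: l => a - 1 / hj (b :: l)

theorem hj_cons (x : ℝ) (l : List ℝ) : hj (x :: l) = x - 1 / hj l := by
  cases l <;> simp [hj]

theorem hj_replicate_two (b : ℕ) : hj (List.replicate b (2 : ℝ)) = ((b : ℝ) + 1) / b := by
  induction b with
  | zero => simp [hj]
  | succ b ih =>
    rw [List.replicate_succ, hj_cons, ih, one_div_div]
    push_cast
    field_simp
    ring

/-- For `n ≥ 2` and nonnegative integers `a`, `b`,
`[[(2)^a, n, (2)^b]] = (((a+1)n − (2a+1))b + (a+1)n − a) / ((an − (2a−1))b + an − (a−1))`. -/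
theorem hj_rep_n_rep (n a b : ℕ) (hn : 2 ≤ n) :
    hj (List.replicate a (2 : ℝ) ++ (n : ℝ) :: List.replicate b (2 : ℝ)) =
      ((((a : ℝ) + 1) * n - (2 * a + 1)) * b + ((a : ℝ) + 1) * n - a) /
        (((a : ℝ) * n - (2 * a - 1)) * b + (a : ℝ) * n - ((a : ℝ) - 1)) := by
  have hn' : (2 : ℝ) ≤ n := by exact_mod_cast hn
  induction a with
  | zero =>
    rw [List.replicate_zero, List.nil_append, hj_cons, hj_replicate_two, one_div_div]
    push_cast
    field_simp
    ring
  | succ a ih =>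
    rw [List.replicate_succ, List.cons_append, hj_cons, ih, one_div_div]
    have hpos : 0 < ((a : ℝ) + 1) * n - (2 * a + 1) := by
      nlinarith [Nat.cast_nonneg (α := ℝ) a]
    have hden : 0 < (((a : ℝ) + 1) * n - (2 * a + 1)) * b + ((a : ℝ) + 1) * n - a := by
      nlinarith [Nat.cast_nonneg (α := ℝ) a, mul_nonneg hpos.le (Nat.cast_nonneg (α := ℝ) b)]
    have hden' : (((a + 1 : ℕ) : ℝ) * n - (2 * ((a + 1 : ℕ) : ℝ) - 1)) * b
        + ((a + 1 : ℕ) : ℝ) * n - (((a + 1 : ℕ) : ℝ) - 1)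
        = (((a : ℝ) + 1) * n - (2 * a + 1)) * b + ((a : ℝ) + 1) * n - a := by
      push_cast
      ring
    rw [hden', eq_div_iff hden.ne', sub_mul, div_mul_cancel₀ _ hden.ne']
    push_cast
    ring
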